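/- arXiv:2010.06513 — 3 statements merged into one kernel-verified Lean document; each statement's English description precedes it below -/
import Mathlib

section
/- Let A be a unital associative ℂ-algebra and let L(u) = (L^a_b(u))_{a,b∈I} be a matrix-valued polynomial in u with entries in A satisfying the RLL relation for the fundamental R-matrix. Then the matrix C(u) with entries C_{ab}(u) := Σ_{c,d∈I} ε^{cd} L_{ca}(u−β) L_{db}(u) is proportional to the metric: there exists a function c : ℂ → A such that C_{ab}(u) = ε_{ab}·c(u) for all u ∈ ℂ and all a,b ∈ I. -/
noncomputable section

/-- The index set `I = {-m,…,-1,(0),1,…,m}` (the value `0` is included iff `zero = true`). -/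
def Idx (m : ℤ) (zero : Bool) : Finset ℤ :=
  if zero then Finset.Icc (-m) m else (Finset.Icc (-m) m).erase 0

/-- The dimension `n` of the fundamental representation: `2m` or `2m+1`. -/
def nDim (m : ℤ) (zero : Bool) : ℤ := if zero then 2 * m + 1 else 2 * m

/-- `β = n/2 - ε`. -/
def betaC (m : ℤ) (zero : Bool) (sgn : ℂ) : ℂ := (nDim m zero : ℂ) / 2 - sgn

/-- The metric `ε_{ab} = ε_a δ_{a,-b}` with `ε_i = 1` for `i ≥ 0`, `ε_{-i} = ε`. -/
def met (sgn : ℂ) (a b : ℤ) : ℂ :=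
  if a = -b then (if 0 ≤ a then 1 else sgn) else 0

/-- The inverse metric `ε^{ab}`, satisfying `Σ_c ε_{ac} ε^{cb} = δ_a^b`. -/
def metUp (sgn : ℂ) (a b : ℤ) : ℂ :=
  if a = -b then (if 0 ≤ b then 1 else sgn) else 0

/-- The fundamental R-matrix
`R(u)^{a₁a₂}_{b₁b₂} = u(u+β) δ^{a₁}_{b₁} δ^{a₂}_{b₂} + (u+β) δ^{a₁}_{b₂} δ^{a₂}_{b₁}
  - ε u ε^{a₁a₂} ε_{b₁b₂}`. -/
def Rmat (m : ℤ) (zero : Bool) (sgn : ℂ) (u : ℂ) (a1 a2 b1 b2 : ℤ) : ℂ :=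
  u * (u + betaC m zero sgn) * (if a1 = b1 then 1 else 0) * (if a2 = b2 then 1 else 0)
    + (u + betaC m zero sgn) * (if a1 = b2 then 1 else 0) * (if a2 = b1 then 1 else 0)
    - sgn * u * metUp sgn a1 a2 * met sgn b1 b2

/-- The RLL relation for a matrix-valued function `L` with entries in a `ℂ`-algebra `A`. -/
def RLL (m : ℤ) (zero : Bool) (sgn : ℂ) {A : Type*} [Ring A] [Algebra ℂ A]
    (L : ℂ → ℤ → ℤ → A) : Prop :=
  ∀ u v : ℂ, ∀ a1 ∈ Idx m zero, ∀ a2 ∈ Idx m zero, ∀ c1 ∈ Idx m zero, ∀ c2 ∈ Idx m zero,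
    (∑ b1 ∈ Idx m zero, ∑ b2 ∈ Idx m zero,
      Rmat m zero sgn (u - v) a1 a2 b1 b2 • (L u b1 c1 * L v b2 c2))
    = ∑ b1 ∈ Idx m zero, ∑ b2 ∈ Idx m zero,
      Rmat m zero sgn (u - v) b1 b2 c1 c2 • (L v a2 b2 * L u a1 b1)

/-- Lowered-index entries `L_{ab}(u) = Σ_c ε_{ac} L^c_b(u)`. -/
def Llow (m : ℤ) (zero : Bool) (sgn : ℂ) {A : Type*} [Ring A] [Algebra ℂ A]
    (L : ℂ → ℤ → ℤ → A) (u : ℂ) (a b : ℤ) : A :=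
  ∑ c ∈ Idx m zero, met sgn a c • L u c b

/-- Lowered-index entries of a single matrix: `M_{ab} = Σ_c ε_{ac} M^c_b`. -/
def lowMat (m : ℤ) (zero : Bool) (sgn : ℂ) {A : Type*} [Ring A] [Algebra ℂ A]
    (M : ℤ → ℤ → A) (a b : ℤ) : A :=
  ∑ c ∈ Idx m zero, met sgn a c • M c b

/-- The entries of `L(u)` are polynomial in the spectral parameter `u`. -/
def IsPolyFam {A : Type*} [Ring A] [Algebra ℂ A] (L : ℂ → ℤ → ℤ → A) : Prop :=
  ∃ (N : ℕ) (coef : ℕ → ℤ → ℤ → A), ∀ (u : ℂ) (a b : ℤ),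
    L u a b = ∑ k ∈ Finset.range (N + 1), u ^ k • coef k a b

/-- A function into a complex vector space that is continuous after composition with every linear
functional and vanishes away from a point also vanishes at that point. -/
theorem eq_zero_of_forall_dual_continuous {A : Type*} [AddCommGroup A] [Module ℂ A] {F : ℂ → A}
    (v : ℂ) (hF : ∀ φ : Module.Dual ℂ A, Continuous fun w => φ (F w))
    (h : ∀ w, w ≠ v → F w = 0) : F v = 0 := by
  rw [← Module.forall_dual_apply_eq_zero_iff ℂ]
  intro φ
  have hd : Dense ({v}ᶜ : Set ℂ) := dense_compl_singleton v
  have := Continuous.ext_on hd (hF φ) (continuous_const (y := (0 : ℂ)))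
    (fun w hw => by simp [h w hw])
  exact congrFun this v

theorem neg_mem_Idx {m : ℤ} {zero : Bool} {a : ℤ} (ha : a ∈ Idx m zero) : -a ∈ Idx m zero := by
  cases zero <;> simp [Idx] at ha ⊢ <;> omega

theorem ne_zero_of_mem_Idx {m a : ℤ} (ha : a ∈ Idx m false) : a ≠ 0 := by
  simp [Idx] at ha
  exact ha.1

theorem sum_Rmat_upper {m : ℤ} {zero : Bool} (sgn u : ℂ) {A : Type*} [AddCommGroup A] [Module ℂ A]
    (g : ℤ → ℤ → A) {a1 a2 : ℤ} (h1 : a1 ∈ Idx m zero) (h2 : a2 ∈ Idx m zero) :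
    ∑ b1 ∈ Idx m zero, ∑ b2 ∈ Idx m zero, Rmat m zero sgn u a1 a2 b1 b2 • g b1 b2
      = (u * (u + betaC m zero sgn)) • g a1 a2 + (u + betaC m zero sgn) • g a2 a1
        - (sgn * u * metUp sgn a1 a2) •
          ∑ b1 ∈ Idx m zero, ∑ b2 ∈ Idx m zero, met sgn b1 b2 • g b1 b2 := by
  simp only [Rmat, sub_smul, add_smul, Finset.sum_sub_distrib, Finset.sum_add_distrib,
    Finset.smul_sum, smul_smul]
  congr 2
  · simp [ite_smul, h1, h2]
  · rw [Finset.sum_comm]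
    simp [ite_smul, add_smul, h1, h2]

theorem sum_Rmat_lower {m : ℤ} {zero : Bool} (sgn u : ℂ) {A : Type*} [AddCommGroup A] [Module ℂ A]
    (g : ℤ → ℤ → A) {c1 c2 : ℤ} (h1 : c1 ∈ Idx m zero) (h2 : c2 ∈ Idx m zero) :
    ∑ b1 ∈ Idx m zero, ∑ b2 ∈ Idx m zero, Rmat m zero sgn u b1 b2 c1 c2 • g b1 b2
      = (u * (u + betaC m zero sgn)) • g c1 c2 + (u + betaC m zero sgn) • g c2 c1
        - (sgn * u * met sgn c1 c2) •
          ∑ b1 ∈ Idx m zero, ∑ b2 ∈ Idx m zero, metUp sgn b1 b2 • g b1 b2 := by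
  simp only [Rmat, sub_smul, add_smul, Finset.sum_sub_distrib, Finset.sum_add_distrib,
    Finset.smul_sum, smul_smul]
  congr 2
  · simp [ite_smul, h1, h2]
  · rw [Finset.sum_comm]
    simp [ite_smul, add_smul, h1, h2]
  · simp only [mul_comm, mul_left_comm]

/-- The contraction identity obtained from the RLL relation at `u - v = -β`, where the R-matrix
degenerates; for `β = 0` it is obtained after dividing the R-matrix by `u - v`. -/
theorem RLL.metUp_smul_eq_met_smul {m : ℤ} {zero : Bool} {sgn : ℂ} (hsgn : sgn ≠ 0)
    {A : Type*} [Ring A] [Algebra ℂ A] {L : ℂ → ℤ → ℤ → A} (hpoly : IsPolyFam L)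
    (hRLL : RLL m zero sgn L) (v : ℂ) {a1 a2 c1 c2 : ℤ}
    (ha1 : a1 ∈ Idx m zero) (ha2 : a2 ∈ Idx m zero)
    (hc1 : c1 ∈ Idx m zero) (hc2 : c2 ∈ Idx m zero) :
    metUp sgn a1 a2 • ∑ b1 ∈ Idx m zero, ∑ b2 ∈ Idx m zero,
        met sgn b1 b2 • (L (v - betaC m zero sgn) b1 c1 * L v b2 c2)
      = met sgn c1 c2 • ∑ b1 ∈ Idx m zero, ∑ b2 ∈ Idx m zero,
        metUp sgn b1 b2 • (L v a2 b2 * L (v - betaC m zero sgn) a1 b1) := by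
  have key := fun w => hRLL w v a1 ha1 a2 ha2 c1 hc1 c2 hc2
  simp only [sum_Rmat_upper sgn _ (fun b1 b2 => L _ b1 c1 * L v b2 c2) ha1 ha2,
    sum_Rmat_lower sgn _ (fun b1 b2 => L v a2 b2 * L _ a1 b1) hc1 hc2] at key
  by_cases hβ : betaC m zero sgn = 0
  · simp only [hβ, add_zero, sub_zero] at key ⊢
    have h0 := eq_zero_of_forall_dual_continuous v
      (F := fun w => (w - v) • (L w a1 c1 * L v a2 c2) + L w a2 c1 * L v a1 c2
        - sgn • metUp sgn a1 a2 • ∑ b1 ∈ Idx m zero, ∑ b2 ∈ Idx m zero,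
            met sgn b1 b2 • (L w b1 c1 * L v b2 c2)
        - ((w - v) • (L v a2 c2 * L w a1 c1) + L v a2 c1 * L w a1 c2
        - sgn • met sgn c1 c2 • ∑ b1 ∈ Idx m zero, ∑ b2 ∈ Idx m zero,
            metUp sgn b1 b2 • (L v a2 b2 * L w a1 b1))) ?_ ?_
    · simp only [sub_self, zero_smul, zero_add] at h0
      rw [sub_sub_sub_cancel_left, sub_eq_zero] at h0
      exact (smul_right_injective A hsgn h0).symm
    · intro φ
      obtain ⟨N, coef, h⟩ := hpoly
      simp only [h, Finset.sum_mul, Finset.mul_sum, smul_mul_assoc, mul_smul_comm, map_add,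
        map_sub, map_smul, map_sum, smul_eq_mul]
      fun_prop
    · intro w hw
      refine (smul_right_injective A (sub_ne_zero.2 hw)) ?_
      have := sub_eq_zero.2 (key w)
      simp only [smul_zero]
      rw [← this]
      module
  · have h := key (v - betaC m zero sgn)
    simp only [sub_sub_cancel_left, neg_add_cancel, mul_zero, zero_smul, zero_add, zero_sub,
      neg_inj] at h
    refine smul_right_injective A (mul_ne_zero hsgn (neg_ne_zero.2 hβ)) ?_
    simpa only [smul_smul] using h

theorem Llow_eq {m : ℤ} {zero : Bool} (sgn : ℂ) {A : Type*} [Ring A] [Algebra ℂ A]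
    (L : ℂ → ℤ → ℤ → A) (u : ℂ) {a : ℤ} (b : ℤ) (ha : a ∈ Idx m zero) :
    Llow m zero sgn L u a b = (if 0 ≤ a then 1 else sgn : ℂ) • L u (-a) b := by
  unfold Llow
  rw [Finset.sum_eq_single_of_mem (-a) (neg_mem_Idx ha)]
  · simp [met]
  · intro c _ hc
    rw [met, if_neg (by omega), zero_smul]

theorem sum_metUp_Llow {m : ℤ} {zero : Bool} {sgn : ℂ} (hsgn : sgn = 1 ∨ sgn = -1)
    (hz : zero = true → sgn = 1) {A : Type*} [Ring A] [Algebra ℂ A]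
    (L : ℂ → ℤ → ℤ → A) (u v : ℂ) (a b : ℤ) :
    ∑ x ∈ Idx m zero, ∑ y ∈ Idx m zero,
        metUp sgn x y • (Llow m zero sgn L u x a * Llow m zero sgn L v y b)
      = sgn • ∑ x ∈ Idx m zero, ∑ y ∈ Idx m zero, met sgn x y • (L u x a * L v y b) := by
  simp only [Finset.smul_sum]
  refine Finset.sum_nbij' (-·) (-·) (fun _ => neg_mem_Idx) (fun _ => neg_mem_Idx)
    (by simp) (by simp) fun x hx => ?_
  refine Finset.sum_nbij' (-·) (-·) (fun _ => neg_mem_Idx) (fun _ => neg_mem_Idx)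
    (by simp) (by simp) fun y hy => ?_
  rw [Llow_eq sgn L u a hx, Llow_eq sgn L v b hy, smul_mul_smul_comm, smul_smul, smul_smul]
  congr 1
  by_cases hxy : x = -y
  · subst hxy
    cases zero
    · have := ne_zero_of_mem_Idx hy
      rcases lt_or_gt_of_ne this with h | h <;> rcases hsgn with rfl | rfl <;>
        simp [met, metUp, h.le, h.not_ge]
    · simp [met, metUp, hz rfl]
  · have hxy' : -x ≠ y := by omega
    simp [metUp, met, hxy, hxy']

/-- the matrix `C(u)` built from an RLL solution is proportional to the metric. -/
theorem stmt0 (m : ℤ) (zero : Bool) (sgn : ℂ) (hm : 1 ≤ m)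
    (hsgn : sgn = 1 ∨ sgn = -1) (hz : zero = true → sgn = 1)
    (A : Type*) [Ring A] [Algebra ℂ A]
    (L : ℂ → ℤ → ℤ → A) (hpoly : IsPolyFam L)
    (hRLL : RLL m zero sgn L) :
    ∃ c : ℂ → A, ∀ u : ℂ, ∀ a ∈ Idx m zero, ∀ b ∈ Idx m zero,
      (∑ x ∈ Idx m zero, ∑ y ∈ Idx m zero,
        metUp sgn x y •
          (Llow m zero sgn L (u - betaC m zero sgn) x a * Llow m zero sgn L u y b))
        = met sgn a b • c u := by
  have h1 : (1 : ℤ) ∈ Idx m zero := by cases zero <;> simp [Idx] <;> omega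
  have hs : sgn ≠ 0 := by rcases hsgn with rfl | rfl <;> simp
  refine ⟨fun u => sgn • ∑ b1 ∈ Idx m zero, ∑ b2 ∈ Idx m zero,
    metUp sgn b1 b2 • (L u 1 b2 * L (u - betaC m zero sgn) (-1) b1), fun u a ha b hb => ?_⟩
  rw [sum_metUp_Llow hsgn hz, smul_comm (met sgn a b),
    ← hRLL.metUp_smul_eq_met_smul hs hpoly u (neg_mem_Idx h1) h1 ha hb]
  simp [metUp]
end
end

section
/- Let A be a unital associative ℂ-algebra and let L(u) = u²·Id + u·G + H satisfy the RLL relation for the fundamental R-matrix. Then there exist elements c₁, c₂, c₃, c₄ ∈ A, each commuting with every entry L_{cd}(v) for all v ∈ ℂ, such that for all a,b ∈ I (in lowered indices): (i) G_{ab} + ε G_{ba} = c₁ ε_{ab}; (ii) H_{ab} + ε H_{ba} + Σ_{d,e} ε^{ed} G_{da} G_{eb} − β G_{ab} = c₂ ε_{ab}; (iii) Σ_{d,e} ε^{ed} (H_{da} G_{eb} + G_{da} H_{eb}) − β(H_{ab} − ε H_{ba}) = c₃ ε_{ab}; (iv) Σ_{d,e} ε^{ed} H_{da} H_{eb} − β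 Σ_{d,e} ε^{ed} G_{da} H_{eb} + β² H_{ab} = c₄ ε_{ab}. -/
noncomputable section

/-- The quadratic evaluation `L(u) = u²·Id + u·G + H`. -/
def Lquad {A : Type*} [Ring A] [Algebra ℂ A] (G H : ℤ → ℤ → A) (u : ℂ) (a b : ℤ) : A :=
  (u ^ 2) • (if a = b then (1 : A) else 0) + u • G a b + H a b

section BilinearForms

variable {A : Type*} [Ring A] [Algebra ℂ A]

/-- The sign `ε_a`. -/
def metSign (s : ℂ) (a : ℤ) : ℂ := if 0 ≤ a then 1 else s

/-- The identity matrix. -/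
def idMat (a b : ℤ) : A := if a = b then 1 else 0

/-- The contraction `∑ ε_{xy} X^x_a Y^y_b` of upper indices. -/
def contrUp (I : Finset ℤ) (s : ℂ) (X Y : ℤ → ℤ → A) (a b : ℤ) : A :=
  ∑ x ∈ I, metSign s x • (X x a * Y (-x) b)

/-- The contraction `∑ ε^{yx} Y^b_x X^a_y` of lower indices. -/
def contrDown (I : Finset ℤ) (s : ℂ) (X Y : ℤ → ℤ → A) (a b : ℤ) : A :=
  ∑ x ∈ I, metSign s x • (Y b x * X a (-x))

/-- A symmetric finite index set on which `s` is a symmetry sign of the metric. -/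
structure IsMetricIndex (I : Finset ℤ) (s : ℂ) : Prop where
  neg_mem : ∀ a ∈ I, -a ∈ I
  sq : s * s = 1
  sign_neg : ∀ a ∈ I, metSign s (-a) = s * metSign s a

lemma isMetricIndex_Idx {m : ℤ} {zero : Bool} {s : ℂ} (hs : s = 1 ∨ s = -1)
    (hz : zero = true → s = 1) : IsMetricIndex (Idx m zero) s where
  neg_mem a ha := by
    unfold Idx at *
    split_ifs at * <;> simp at * <;> omega
  sq := by rcases hs with rfl | rfl <;> norm_num
  sign_neg a ha := by
    have hsq : s * s = 1 := by rcases hs with rfl | rfl <;> norm_num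
    have h0 : a = 0 → s = 1 := by
      rintro rfl
      apply hz
      by_contra h
      simp [Idx, h] at ha
    unfold metSign
    rcases lt_trichotomy a 0 with h | h | h
    · rw [if_pos (by omega), if_neg (by omega), hsq]
    · simp [h, h0 h]
    · rw [if_neg (by omega), if_pos h.le, mul_one]

lemma met_eq (s : ℂ) (a b : ℤ) : met s a b = if a = -b then metSign s a else 0 := rfl

lemma metUp_eq (s : ℂ) (a b : ℤ) : metUp s a b = if a = -b then metSign s b else 0 := rfl

variable {I : Finset ℤ} {s : ℂ}

lemma IsMetricIndex.sign_sq (hI : IsMetricIndex I s) (a : ℤ) :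
    metSign s a * metSign s a = 1 := by
  unfold metSign
  split_ifs
  · norm_num
  · exact hI.sq

lemma IsMetricIndex.sum_neg (hI : IsMetricIndex I s) {M : Type*} [AddCommMonoid M]
    (f : ℤ → M) : ∑ x ∈ I, f (-x) = ∑ x ∈ I, f x :=
  Finset.sum_nbij' (fun x => -x) (fun x => -x) hI.neg_mem hI.neg_mem (by simp) (by simp)
    (by simp)

lemma IsMetricIndex.sum_ite_eq_neg (hI : IsMetricIndex I s) {M : Type*} [AddCommMonoid M]
    {a : ℤ} (ha : a ∈ I) (f : ℤ → M) : (∑ x ∈ I, if a = -x then f x else 0) = f (-a) := by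
  rw [Finset.sum_eq_single (-a)]
  · simp
  · intro b _ hb
    rw [if_neg (by omega)]
  · exact fun h => absurd (hI.neg_mem a ha) h

lemma IsMetricIndex.sum_ite_neg_eq (hI : IsMetricIndex I s) {M : Type*} [AddCommMonoid M]
    {a : ℤ} (ha : a ∈ I) (f : ℤ → M) : (∑ x ∈ I, if x = -a then f x else 0) = f (-a) := by
  rw [Finset.sum_ite_eq' I (-a) f, if_pos (hI.neg_mem a ha)]

/-- Collapse of the sum of `met`-type coefficients. -/
lemma IsMetricIndex.sum_met_smul (hI : IsMetricIndex I s) {a : ℤ} (ha : a ∈ I) (f : ℤ → A) :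
    ∑ c ∈ I, met s a c • f c = metSign s a • f (-a) := by
  simp only [met_eq, ite_smul, zero_smul]
  exact hI.sum_ite_eq_neg ha fun c => metSign s a • f c

lemma lowMat_eq {m : ℤ} {zero : Bool} (hI : IsMetricIndex (Idx m zero) s) {a : ℤ}
    (ha : a ∈ Idx m zero) (X : ℤ → ℤ → A) (b : ℤ) :
    lowMat m zero s X a b = metSign s a • X (-a) b :=
  hI.sum_met_smul ha fun c => X c b

lemma sum_metUp_lowMat {m : ℤ} {zero : Bool} (hI : IsMetricIndex (Idx m zero) s)
    (X Y : ℤ → ℤ → A) (a b : ℤ) :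
    ∑ d ∈ Idx m zero, ∑ e ∈ Idx m zero,
      metUp s e d • (lowMat m zero s X d a * lowMat m zero s Y e b)
      = contrUp (Idx m zero) s X Y a b := by
  rw [contrUp, ← hI.sum_neg fun x => metSign s x • (X x a * Y (-x) b)]
  refine Finset.sum_congr rfl fun d hd => ?_
  simp only [metUp_eq, ite_smul, zero_smul]
  rw [hI.sum_ite_neg_eq hd, lowMat_eq hI hd, lowMat_eq hI (hI.neg_mem d hd), smul_mul_smul_comm,
    smul_smul, ← mul_assoc, hI.sign_sq, one_mul, neg_neg]

lemma contrUp_add_left (X X' Y : ℤ → ℤ → A) (a b : ℤ) :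
    contrUp I s (X + X') Y a b = contrUp I s X Y a b + contrUp I s X' Y a b := by
  simp [contrUp, add_mul, Finset.sum_add_distrib]

lemma contrUp_add_right (X Y Y' : ℤ → ℤ → A) (a b : ℤ) :
    contrUp I s X (Y + Y') a b = contrUp I s X Y a b + contrUp I s X Y' a b := by
  simp [contrUp, mul_add, Finset.sum_add_distrib]

lemma contrUp_smul_left (k : ℂ) (X Y : ℤ → ℤ → A) (a b : ℤ) :
    contrUp I s (k • X) Y a b = k • contrUp I s X Y a b := by
  simp [contrUp, Finset.smul_sum, smul_comm k]

lemma contrUp_smul_right (k : ℂ) (X Y : ℤ → ℤ → A) (a b : ℤ) :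
    contrUp I s X (k • Y) a b = k • contrUp I s X Y a b := by
  simp [contrUp, Finset.smul_sum, smul_comm k]

lemma contrUp_idMat_left {a : ℤ} (ha : a ∈ I) (Y : ℤ → ℤ → A) (b : ℤ) :
    contrUp I s idMat Y a b = metSign s a • Y (-a) b := by
  simp [contrUp, idMat, ha]

lemma IsMetricIndex.contrUp_idMat_right (hI : IsMetricIndex I s) {b : ℤ} (hb : b ∈ I)
    (X : ℤ → ℤ → A) (a : ℤ) :
    contrUp I s X idMat a b = s • metSign s b • X (-b) a := by
  rw [contrUp, Finset.sum_eq_single (-b)]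
  · simp [idMat, hI.sign_neg b hb, mul_smul]
  · intro x _ hx
    simp [idMat, show ¬ -x = b by omega]
  · exact fun h => absurd (hI.neg_mem b hb) h

lemma contrDown_add_left (X X' Y : ℤ → ℤ → A) (a b : ℤ) :
    contrDown I s (X + X') Y a b = contrDown I s X Y a b + contrDown I s X' Y a b := by
  simp [contrDown, mul_add, Finset.sum_add_distrib]

lemma contrDown_smul_left (k : ℂ) (X Y : ℤ → ℤ → A) (a b : ℤ) :
    contrDown I s (k • X) Y a b = k • contrDown I s X Y a b := by
  simp [contrDown, Finset.smul_sum, smul_comm k]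

lemma IsMetricIndex.contrDown_idMat_left (hI : IsMetricIndex I s) {a : ℤ} (ha : a ∈ I)
    (Y : ℤ → ℤ → A) (b : ℤ) :
    contrDown I s idMat Y a b = s • metSign s a • Y b (-a) := by
  rw [contrDown, Finset.sum_eq_single (-a)]
  · simp [idMat, hI.sign_neg a ha, mul_smul]
  · intro x _ hx
    simp [idMat, show ¬ a = -x by omega]
  · exact fun h => absurd (hI.neg_mem a ha) h

lemma Lquad_eq (G H : ℤ → ℤ → A) (u : ℂ) : Lquad G H u = u ^ 2 • idMat + u • G + H := rfl

end BilinearForms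

section Relations

variable {A : Type*} [Ring A] [Algebra ℂ A] {m : ℤ} {zero : Bool} {s : ℂ}

/-- The RLL relation with the sums over the R-matrix indices carried out. -/
lemma RLL.contracted {L : ℂ → ℤ → ℤ → A} (h : RLL m zero s L)
    (hI : IsMetricIndex (Idx m zero) s) (u v : ℂ) {a₁ a₂ c₁ c₂ : ℤ} (ha₁ : a₁ ∈ Idx m zero)
    (ha₂ : a₂ ∈ Idx m zero) (hc₁ : c₁ ∈ Idx m zero) (hc₂ : c₂ ∈ Idx m zero) :
    ((u - v) * (u - v + betaC m zero s)) • (L u a₁ c₁ * L v a₂ c₂)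
      + (u - v + betaC m zero s) • (L u a₂ c₁ * L v a₁ c₂)
      - (s * (u - v) * metUp s a₁ a₂) • contrUp (Idx m zero) s (L u) (L v) c₁ c₂
    = ((u - v) * (u - v + betaC m zero s)) • (L v a₂ c₂ * L u a₁ c₁)
      + (u - v + betaC m zero s) • (L v a₂ c₁ * L u a₁ c₂)
      - (s * (u - v) * met s c₁ c₂) • contrDown (Idx m zero) s (L u) (L v) a₁ a₂ := by
  have key := h u v a₁ ha₁ a₂ ha₂ c₁ hc₁ c₂ hc₂
  simp only [Rmat, sub_smul, add_smul, Finset.sum_sub_distrib, Finset.sum_add_distrib] at key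
  convert key using 2
  · congr 1
    · simp [ha₁, ha₂, mul_ite, ite_smul]
    · rw [Finset.sum_comm]
      simp [ha₁, ha₂, mul_ite, ite_smul]
  · rw [contrUp, Finset.smul_sum]
    refine Finset.sum_congr rfl fun x hx => ?_
    simp only [mul_smul, ← Finset.smul_sum]
    rw [hI.sum_met_smul hx]
  · congr 1
    · simp [hc₁, hc₂, mul_ite, ite_smul]
    · rw [Finset.sum_comm]
      simp [hc₁, hc₂, mul_ite, ite_smul]
  · rw [contrDown, Finset.smul_sum, Finset.sum_comm]
    refine Finset.sum_congr rfl fun x hx => ?_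
    simp only [metUp_eq, mul_ite, ite_mul, zero_mul, mul_zero, ite_smul, zero_smul]
    rw [hI.sum_ite_neg_eq hx, smul_smul]
    congr 1
    ring

lemma coeffs_eq_zero {a₀ a₁ a₂ a₃ a₄ : A}
    (h : ∀ v : ℂ, v ^ 4 • a₄ + v ^ 3 • a₃ + v ^ 2 • a₂ + v • a₁ + a₀ = 0) :
    a₀ = 0 ∧ a₁ = 0 ∧ a₂ = 0 ∧ a₃ = 0 ∧ a₄ = 0 := by
  have h0 := h 0
  have h1 := h 1
  have h2 := h (-1)
  have h3 := h 2
  have h4 := h (-2)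
  refine ⟨?_, ?_, ?_, ?_, ?_⟩
  · linear_combination (norm := module) h0
  · linear_combination (norm := module) (2 / 3 : ℂ) • h1 - (2 / 3 : ℂ) • h2 - (1 / 12 : ℂ) • h3
      + (1 / 12 : ℂ) • h4
  · linear_combination (norm := module) (2 / 3 : ℂ) • h1 + (2 / 3 : ℂ) • h2 - (1 / 24 : ℂ) • h3
      - (1 / 24 : ℂ) • h4 - (5 / 4 : ℂ) • h0
  · linear_combination (norm := module) (1 / 12 : ℂ) • h3 - (1 / 12 : ℂ) • h4 - (1 / 6 : ℂ) • h1
      + (1 / 6 : ℂ) • h2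
  · linear_combination (norm := module) (1 / 24 : ℂ) • h3 + (1 / 24 : ℂ) • h4 - (1 / 6 : ℂ) • h1
      - (1 / 6 : ℂ) • h2 + (1 / 4 : ℂ) • h0

variable {G H : ℤ → ℤ → A}

/-- The coefficients of `G` act on `L(v)` as the orthogonal or symplectic Lie algebra. -/
lemma RLL.commutator_linear (h : RLL m zero s (Lquad G H))
    (hI : IsMetricIndex (Idx m zero) s) (v : ℂ) {a₁ a₂ c₁ c₂ : ℤ} (ha₁ : a₁ ∈ Idx m zero)
    (ha₂ : a₂ ∈ Idx m zero) (hc₁ : c₁ ∈ Idx m zero) (hc₂ : c₂ ∈ Idx m zero) :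
    G a₁ c₁ * Lquad G H v a₂ c₂ - Lquad G H v a₂ c₂ * G a₁ c₁ =
      (if a₁ = c₂ then Lquad G H v a₂ c₁ else 0) - (if a₂ = c₁ then Lquad G H v a₁ c₂ else 0)
      + (s * metUp s a₁ a₂ * metSign s c₁) • Lquad G H v (-c₁) c₂
      - (met s c₁ c₂ * metSign s a₁) • Lquad G H v a₂ (-a₁) := by
  have key := fun u => h.contracted hI u v ha₁ ha₂ hc₁ hc₂
  have hss := hI.sq
  generalize Lquad G H v = M at key ⊢
  simp only [Lquad_eq, contrUp_add_left, contrUp_smul_left, contrDown_add_left,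
    contrDown_smul_left, contrUp_idMat_left hc₁, hI.contrDown_idMat_left ha₁, Pi.add_apply,
    Pi.smul_apply, add_mul, mul_add, smul_mul_assoc, mul_smul_comm] at key
  have i₁ : ∀ x : A, (idMat a₁ c₁ : A) * x = x * idMat a₁ c₁ := by
    intro x; unfold idMat; split_ifs <;> simp
  have i₂ : (idMat a₂ c₁ : A) * M a₁ c₂ = if a₂ = c₁ then M a₁ c₂ else 0 := by
    unfold idMat; split_ifs <;> simp
  have i₃ : M a₂ c₁ * (idMat a₁ c₂ : A) = if a₁ = c₂ then M a₂ c₁ else 0 := by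
    unfold idMat; split_ifs <;> simp
  rw [← i₂, ← i₃]
  simp only [i₁] at key
  have k0 := key v
  have k1 := key (v + 1)
  have k2 := key (v + 2)
  have k3 := key (v + 3)
  have e : (s * s) • (met s c₁ c₂ * metSign s a₁) • M a₂ (-a₁)
      = (met s c₁ c₂ * metSign s a₁) • M a₂ (-a₁) := by rw [hss, one_smul]
  linear_combination (norm := module) (1 / 6 : ℂ) • k3 - (1 / 2 : ℂ) • k2 + (1 / 2 : ℂ) • k1
    - (1 / 6 : ℂ) • k0 - e

/-- For `β = 0` the algebra is `so(2)`. -/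
lemma betaC_eq_zero_imp (hs : s = 1 ∨ s = -1) (hm : 1 ≤ m) (hβ : betaC m zero s = 0) :
    m = 1 ∧ zero = false ∧ s = 1 := by
  have h2 : (nDim m zero : ℂ) = 2 * s := by
    unfold betaC at hβ
    linear_combination 2 * hβ
  rcases hs with rfl | rfl
  · have h3 : nDim m zero = 2 := by exact_mod_cast (by simpa using h2 : (nDim m zero : ℂ) = 2)
    cases zero
    · simp only [nDim, Bool.false_eq_true, if_false] at h3
      exact ⟨by omega, rfl, rfl⟩
    · simp only [nDim, if_true] at h3
      omega
  · have h3 : nDim m zero = -2 := by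
      exact_mod_cast (by simpa using h2 : (nDim m zero : ℂ) = -2)
    cases zero <;> simp [nDim] at h3 <;> omega

lemma Idx_one_false : Idx 1 false = {1, -1} := by decide

/-- For `so(2)` the off-diagonal entries vanish. -/
lemma RLL.offDiag_eq_zero (h : RLL 1 false 1 (Lquad G H)) (u : ℂ) {a : ℤ}
    (ha : a ∈ Idx 1 false) : Lquad G H u a (-a) = 0 := by
  have hI : IsMetricIndex (Idx 1 false) 1 := isMetricIndex_Idx (Or.inl rfl) (by simp)
  have hβ : betaC 1 false 1 = 0 := by norm_num [betaC, nDim]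
  have hna := hI.neg_mem a ha
  have hane : a ≠ -a := by
    rw [Idx_one_false] at ha
    simp at ha
    omega
  have hsum : ∀ f : ℤ → A, ∑ x ∈ Idx 1 false, f x = f a + f (-a) := by
    intro f
    rw [Idx_one_false] at ha ⊢
    rw [Finset.sum_pair (by norm_num)]
    rcases Finset.mem_insert.1 ha with rfl | ha
    · rfl
    · rw [Finset.mem_singleton.1 ha, neg_neg, add_comm]
  have hz : ∀ v : ℂ, Lquad G H (v + 1) a a * Lquad G H v a (-a) = 0 := by
    intro v
    have key := h.contracted hI (v + 1) v ha ha ha hna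
    simp only [hβ, contrDown, hsum, metUp_eq, met_eq, neg_neg, if_neg hane, if_true,
      metSign, ite_self] at key
    linear_combination (norm := module) (1 / 2 : ℂ) • key
  have hz' : ∀ v : ℂ, v ^ 4 • (0 : A) + v ^ 3 • G a (-a)
      + v ^ 2 • (H a (-a) + (2 : ℂ) • G a (-a) + G a a * G a (-a))
      + v • ((2 : ℂ) • H a (-a) + G a (-a) + G a a * G a (-a) + H a a * G a (-a)
        + G a a * H a (-a))
      + (H a (-a) + G a a * H a (-a) + H a a * H a (-a)) = 0 := by
    intro v
    have := hz v
    simp only [Lquad, if_true, if_neg hane, smul_zero, zero_add, add_mul, mul_add,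
      smul_mul_assoc, mul_smul_comm, one_mul] at this
    linear_combination (norm := module) this
  obtain ⟨-, -, h2, h3, -⟩ := coeffs_eq_zero hz'
  rw [h3] at h2
  simp only [smul_zero, mul_zero, add_zero] at h2
  simp [Lquad, hane, h2, h3]

/-- For `so(2)` the two diagonal entries commute. -/
lemma RLL.diag_commute (h : RLL 1 false 1 (Lquad G H)) (v : ℂ) :
    Lquad G H v 1 1 * Lquad G H v (-1) (-1) = Lquad G H v (-1) (-1) * Lquad G H v 1 1 := by
  have hI : IsMetricIndex (Idx 1 false) 1 := isMetricIndex_Idx (Or.inl rfl) (by simp)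
  have hβ : betaC 1 false 1 = 0 := by norm_num [betaC, nDim]
  have h1 : (1 : ℤ) ∈ Idx 1 false := by decide
  have hn1 : (-1 : ℤ) ∈ Idx 1 false := by decide
  have hsum : ∀ f : ℤ → A, ∑ x ∈ Idx 1 false, f x = f 1 + f (-1) := by
    intro f
    rw [Idx_one_false, Finset.sum_pair (by norm_num)]
  have z₁ : ∀ u, Lquad G H u 1 (-1) = 0 := fun u => h.offDiag_eq_zero u h1
  have z₂ : ∀ u, Lquad G H u (-1) 1 = 0 := fun u => by
    simpa using h.offDiag_eq_zero u hn1
  have key : ∀ u, ((u - v) * (u - v - 1)) •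
      (Lquad G H u 1 1 * Lquad G H v (-1) (-1) - Lquad G H v (-1) (-1) * Lquad G H u 1 1)
      = 0 := by
    intro u
    have := h.contracted hI u v h1 hn1 h1 hn1
    simp only [hβ, contrUp, contrDown, hsum, metUp_eq, met_eq, neg_neg, z₁, z₂, if_true,
      metSign, ite_self, mul_zero] at this
    linear_combination (norm := module) this
  have k2 := key (v + 2)
  have k3 := key (v + 3)
  generalize Lquad G H v (-1) (-1) = D at *
  simp only [Lquad, if_true, add_mul, mul_add, smul_mul_assoc, mul_smul_comm, one_mul,
    mul_one] at k2 k3 ⊢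
  linear_combination (norm := module) (3 / 2 : ℂ) • k2 - (1 / 3 : ℂ) • k3

/-- The two contractions of `L(v - β)` with `L(v)` are proportional to the metric. -/
lemma RLL.contr_proportional (h : RLL m zero s (Lquad G H))
    (hI : IsMetricIndex (Idx m zero) s) (hs : s = 1 ∨ s = -1) (hm : 1 ≤ m) (v : ℂ)
    {a₁ a₂ c₁ c₂ : ℤ} (ha₁ : a₁ ∈ Idx m zero) (ha₂ : a₂ ∈ Idx m zero) (hc₁ : c₁ ∈ Idx m zero)
    (hc₂ : c₂ ∈ Idx m zero) :
    metUp s a₁ a₂ •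
        contrUp (Idx m zero) s (Lquad G H (v - betaC m zero s)) (Lquad G H v) c₁ c₂
      = met s c₁ c₂ •
        contrDown (Idx m zero) s (Lquad G H (v - betaC m zero s)) (Lquad G H v) a₁ a₂ := by
  by_cases hβ : betaC m zero s = 0
  · obtain ⟨rfl, rfl, rfl⟩ := betaC_eq_zero_imp hs hm hβ
    have z₁ : ∀ u, Lquad G H u 1 (-1) = 0 := fun u => h.offDiag_eq_zero u (by decide)
    have z₂ : ∀ u, Lquad G H u (-1) 1 = 0 := fun u => by
      simpa using h.offDiag_eq_zero u (a := -1) (by decide)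
    have hc := h.diag_commute v
    simp only [hβ, sub_zero, contrUp, contrDown]
    simp only [Idx_one_false, Finset.mem_insert, Finset.mem_singleton] at *
    rcases ha₁ with rfl | rfl <;> rcases ha₂ with rfl | rfl <;> rcases hc₁ with rfl | rfl <;>
      rcases hc₂ with rfl | rfl <;> simp [metUp, met, metSign, z₁, z₂, hc]
  · have key := h.contracted hI (v - betaC m zero s) v ha₁ ha₂ hc₁ hc₂
    have hk : (s * -betaC m zero s) • (metUp s a₁ a₂ •
        contrUp (Idx m zero) s (Lquad G H (v - betaC m zero s)) (Lquad G H v) c₁ c₂)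
      = (s * -betaC m zero s) • (met s c₁ c₂ •
        contrDown (Idx m zero) s (Lquad G H (v - betaC m zero s)) (Lquad G H v) a₁ a₂) := by
      linear_combination (norm := module) - (1 : ℂ) • key
    have hs0 : s ≠ 0 := by rcases hs with rfl | rfl <;> norm_num
    exact smul_right_injective A (mul_ne_zero hs0 (neg_ne_zero.2 hβ)) hk

lemma contrUp_Lquad (hI : IsMetricIndex (Idx m zero) s) (β v : ℂ) {a b : ℤ}
    (ha : a ∈ Idx m zero) (hb : b ∈ Idx m zero) :
    contrUp (Idx m zero) s (Lquad G H (v - β)) (Lquad G H v) a b =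
      v ^ 4 • met s a b • (1 : A)
      + v ^ 3 • (lowMat m zero s G a b + s • lowMat m zero s G b a - (2 * β * met s a b) • (1 : A))
      + v ^ 2 • (lowMat m zero s H a b + s • lowMat m zero s H b a
        + contrUp (Idx m zero) s G G a b - (β * s) • lowMat m zero s G b a
        - (2 * β) • lowMat m zero s G a b + (β ^ 2 * met s a b) • (1 : A))
      + v • (contrUp (Idx m zero) s H G a b + contrUp (Idx m zero) s G H a b
        - (2 * β) • lowMat m zero s H a b - β • contrUp (Idx m zero) s G G a b
        + β ^ 2 • lowMat m zero s G a b)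
      + (contrUp (Idx m zero) s H H a b - β • contrUp (Idx m zero) s G H a b
        + β ^ 2 • lowMat m zero s H a b) := by
  have h1 : s • metSign s b • (idMat (-b) a : A) = met s a b • (1 : A) := by
    by_cases hab : a = -b
    · simp [met_eq, idMat, hab, hI.sign_neg b hb, mul_smul]
    · simp [met_eq, idMat, hab, show ¬ -b = a by omega]
  simp only [Lquad_eq, contrUp_add_left, contrUp_smul_left, contrUp_add_right,
    contrUp_smul_right, contrUp_idMat_left ha, hI.contrUp_idMat_right hb, lowMat_eq hI ha,
    lowMat_eq hI hb, Pi.add_apply, Pi.smul_apply]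
  linear_combination (norm := module) (v ^ 2 * (v - β) ^ 2) • h1

section Centrality

variable {I : Finset ℤ} {X Y : ℤ → ℤ → A} {C : A}

lemma IsMetricIndex.commute_of_contr (hI : IsMetricIndex I s)
    (hup : ∀ a ∈ I, ∀ b ∈ I, contrUp I s X Y a b = met s a b • C)
    (hdown : ∀ a ∈ I, ∀ b ∈ I, contrDown I s X Y a b = metUp s a b • C)
    {a d : ℤ} (ha : a ∈ I) (hd : d ∈ I) : C * Y a d = Y a d * C := by
  have hsign : ∀ x ∈ I, metSign s (-x) * metSign s x = s := fun x hx => by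
    rw [hI.sign_neg x hx, mul_assoc, hI.sign_sq, mul_one]
  have e₁ : ∑ x ∈ I, metSign s x • (contrDown I s X Y x a * Y (-x) d) = s • (C * Y a d) := by
    have : ∀ x ∈ I, metSign s x • (contrDown I s X Y x a * Y (-x) d) =
        if x = -a then metSign s x • metSign s a • (C * Y (-x) d) else 0 := by
      intro x hx
      rw [hdown x hx a ha, metUp_eq]
      split_ifs <;> simp
    rw [Finset.sum_congr rfl this, hI.sum_ite_neg_eq ha, neg_neg, smul_smul, hsign a ha]
  have e₂ : ∑ x ∈ I, metSign s x • (Y a x * contrUp I s X Y (-x) d) = s • (Y a d * C) := by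
    have : ∀ x ∈ I, metSign s x • (Y a x * contrUp I s X Y (-x) d) =
        if x = d then metSign s (-x) • metSign s x • (Y a x * C) else 0 := by
      intro x hx
      rw [hup (-x) (hI.neg_mem x hx) d hd, met_eq]
      simp only [neg_inj]
      split_ifs <;> simp [smul_comm (metSign s x)]
    rw [Finset.sum_congr rfl this, Finset.sum_ite_eq' I d, if_pos hd, smul_smul, hsign d hd]
  have e₃ : ∑ x ∈ I, metSign s x • (contrDown I s X Y x a * Y (-x) d)
      = ∑ x ∈ I, metSign s x • (Y a x * contrUp I s X Y (-x) d) := by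
    simp only [contrDown, contrUp, Finset.sum_mul, Finset.mul_sum, Finset.smul_sum]
    rw [Finset.sum_comm]
    refine Finset.sum_congr rfl fun x _ => Finset.sum_congr rfl fun y _ => ?_
    simp only [smul_mul_assoc, mul_smul_comm, mul_assoc]
    rw [smul_comm]
  rw [e₁, e₂] at e₃
  have := congrArg (s • ·) e₃
  simpa [smul_smul, hI.sq] using this

/-- The commutator of the generator `F^a_c` with the entries of `X` is the infinitesimal
orthogonal or symplectic transformation. -/
def IsCovariant (I : Finset ℤ) (s : ℂ) (F X : ℤ → ℤ → A) : Prop :=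
  ∀ a ∈ I, ∀ c ∈ I, ∀ x ∈ I, ∀ y ∈ I, F a c * X x y - X x y * F a c =
    (if a = y then X x c else 0) - (if x = c then X a y else 0)
      + (s * metUp s a x * metSign s c) • X (-c) y - (met s c y * metSign s a) • X x (-a)

lemma IsMetricIndex.commutator_contrUp (hI : IsMetricIndex I s) {F : ℤ → ℤ → A}
    (hX : IsCovariant I s F X) (hY : IsCovariant I s F Y) {a c p q : ℤ} (ha : a ∈ I)
    (hc : c ∈ I) (hp : p ∈ I) (hq : q ∈ I) :
    F a c * contrUp I s X Y p q - contrUp I s X Y p q * F a c =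
      (if a = p then contrUp I s X Y c q else 0)
      - (met s c p * metSign s a) • contrUp I s X Y (-a) q
      + (if a = q then contrUp I s X Y p c else 0)
      - (met s c q * metSign s a) • contrUp I s X Y p (-a) := by
  have t₁ : ∑ x ∈ I, metSign s x • ((if x = c then X a p else 0) * Y (-x) q)
      = metSign s c • (X a p * Y (-c) q) := by
    simp [ite_mul, smul_ite, hc]
  have t₂ : ∑ x ∈ I, metSign s x •
      (((s * metUp s a x * metSign s c) • X (-c) p) * Y (-x) q)
      = (s * metSign s c) • (X (-c) p * Y a q) := by
    have : ∀ x ∈ I, metSign s x • (((s * metUp s a x * metSign s c) • X (-c) p) * Y (-x) q) =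
        if a = -x then (s * metSign s c) • (X (-c) p * Y (-x) q) else 0 := by
      intro x _
      rw [metUp_eq]
      split_ifs
      · rw [smul_mul_assoc, smul_smul]
        congr 1
        linear_combination (s * metSign s c) * hI.sign_sq x
      · simp
    rw [Finset.sum_congr rfl this, hI.sum_ite_eq_neg ha, neg_neg]
  have t₃ : ∑ x ∈ I, metSign s x • (X x p * (if -x = c then Y a q else 0))
      = (s * metSign s c) • (X (-c) p * Y a q) := by
    have : ∀ x ∈ I, metSign s x • (X x p * (if -x = c then Y a q else 0)) =
        if c = -x then metSign s x • (X x p * Y a q) else 0 := by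
      intro x _
      by_cases hx : c = -x
      · rw [if_pos hx, if_pos hx.symm]
      · rw [if_neg hx, if_neg (Ne.symm hx), mul_zero, smul_zero]
    rw [Finset.sum_congr rfl this, hI.sum_ite_eq_neg hc, hI.sign_neg c hc]
  have t₄ : ∑ x ∈ I, metSign s x •
      (X x p * ((s * metUp s a (-x) * metSign s c) • Y (-c) q))
      = metSign s c • (X a p * Y (-c) q) := by
    have : ∀ x ∈ I, metSign s x • (X x p * ((s * metUp s a (-x) * metSign s c) • Y (-c) q)) =
        if x = a then metSign s c • (X x p * Y (-c) q) else 0 := by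
      intro x hx
      rw [metUp_eq, neg_neg, eq_comm, hI.sign_neg x hx]
      split_ifs with h1 h2 h2
      · rw [mul_smul_comm, smul_smul]
        congr 1
        linear_combination (- metSign s c * metSign s x * metSign s x) * hI.sq
          - (metSign s c) * hI.sign_sq x
      · exact absurd h1.symm h2
      · exact absurd h2.symm h1
      · simp
    rw [Finset.sum_congr rfl this, Finset.sum_ite_eq' I a, if_pos ha]
  have t₅ : ∀ (P : Prop) [Decidable P],
      ∑ x ∈ I, metSign s x • ((if P then X x c else 0) * Y (-x) q)
      = if P then contrUp I s X Y c q else 0 := by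
    intro P _
    split_ifs <;> simp [contrUp]
  have t₆ : ∀ (P : Prop) [Decidable P],
      ∑ x ∈ I, metSign s x • (X x p * (if P then Y (-x) c else 0))
      = if P then contrUp I s X Y p c else 0 := by
    intro P _
    split_ifs <;> simp [contrUp]
  have t₇ : ∀ k : ℂ, ∑ x ∈ I, metSign s x • ((k • X x (-a)) * Y (-x) q)
      = k • contrUp I s X Y (-a) q := by
    intro k
    simp [contrUp, Finset.smul_sum, smul_comm k]
  have t₈ : ∀ k : ℂ, ∑ x ∈ I, metSign s x • (X x p * (k • Y (-x) (-a)))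
      = k • contrUp I s X Y p (-a) := by
    intro k
    simp [contrUp, Finset.smul_sum, smul_comm k]
  have leibniz : ∀ x ∈ I, F a c * (metSign s x • (X x p * Y (-x) q))
      - (metSign s x • (X x p * Y (-x) q)) * F a c
      = metSign s x • ((F a c * X x p - X x p * F a c) * Y (-x) q)
        + metSign s x • (X x p * (F a c * Y (-x) q - Y (-x) q * F a c)) := by
    intro x _
    simp only [mul_smul_comm, smul_mul_assoc, sub_mul, mul_sub, mul_assoc]
    module
  have expand : F a c * contrUp I s X Y p q - contrUp I s X Y p q * F a c
      = ∑ x ∈ I, (metSign s x • ((F a c * X x p - X x p * F a c) * Y (-x) q)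
        + metSign s x • (X x p * (F a c * Y (-x) q - Y (-x) q * F a c))) := by
    rw [← Finset.sum_congr rfl leibniz, Finset.sum_sub_distrib, ← Finset.mul_sum,
      ← Finset.sum_mul]
    rfl
  rw [expand, Finset.sum_congr rfl fun x hx => by
    rw [hX a ha c hc x hx p hp, hY a ha c hc (-x) (hI.neg_mem x hx) q hq]]
  simp only [sub_mul, add_mul, mul_sub, mul_add, smul_sub, smul_add, Finset.sum_add_distrib,
    Finset.sum_sub_distrib]
  rw [t₁, t₂, t₃, t₄, t₅, t₆, t₇, t₈]
  module

lemma IsMetricIndex.commute_of_covariant (hI : IsMetricIndex I s) {F : ℤ → ℤ → A}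
    (hX : IsCovariant I s F X) (hY : IsCovariant I s F Y)
    (hup : ∀ a ∈ I, ∀ b ∈ I, contrUp I s X Y a b = met s a b • C)
    {a c : ℤ} (ha : a ∈ I) (hc : c ∈ I) : C * F a c = F a c * C := by
  have hna := hI.neg_mem a ha
  have key := hI.commutator_contrUp hX hY ha hc ha hna
  have hx : C = metSign s a • contrUp I s X Y a (-a) := by
    rw [hup a ha _ hna, met_eq, neg_neg, if_pos rfl, smul_smul, hI.sign_sq, one_smul]
  rw [hup c hc _ hna, hup _ hna _ hna, hup a ha c hc] at key
  have hm : met s a (-a) = metSign s a := by simp [met_eq]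
  have hswap : met s a c = s * met s c a := by
    simp only [met_eq]
    by_cases hac : a = -c
    · rw [if_pos hac, if_pos (by omega), hac, hI.sign_neg c hc]
    · rw [if_neg hac, if_neg (by omega), mul_zero]
  have hz : F a c * contrUp I s X Y a (-a) - contrUp I s X Y a (-a) * F a c = 0 := by
    rw [key, hup a ha _ hna, hm, if_pos rfl, hswap]
    by_cases h0 : a = -a
    · have hs1 := hI.sign_neg a ha
      rw [← h0] at hs1 hm
      rw [if_pos h0, ← h0, hm]
      match_scalars
      linear_combination (-met s c a - s * met s c a) * hI.sign_sq a
        - met s c a * metSign s a * hs1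
    · have : met s (-a) (-a) = 0 := by
        rw [met_eq, if_neg (by omega)]
      rw [if_neg h0, this]
      match_scalars
      linear_combination (-met s c (-a)) * hI.sign_sq a
  rw [hx, smul_mul_assoc, mul_smul_comm, sub_eq_zero.1 hz]

end Centrality

/-- The contractions of `L(v - β)` with `L(v)` are the metric times a quartic polynomial. -/
lemma RLL.exists_quartic (h : RLL m zero s (Lquad G H))
    (hI : IsMetricIndex (Idx m zero) s) (hs : s = 1 ∨ s = -1) (hm : 1 ≤ m) :
    ∃ k₁ k₂ k₃ k₄ : A, ∀ v : ℂ, ∀ a ∈ Idx m zero, ∀ b ∈ Idx m zero,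
      contrUp (Idx m zero) s (Lquad G H (v - betaC m zero s)) (Lquad G H v) a b
        = met s a b • (v ^ 4 • 1 + v ^ 3 • k₁ + v ^ 2 • k₂ + v • k₃ + k₄) ∧
      contrDown (Idx m zero) s (Lquad G H (v - betaC m zero s)) (Lquad G H v) a b
        = metUp s a b • (v ^ 4 • 1 + v ^ 3 • k₁ + v ^ 2 • k₂ + v • k₃ + k₄) := by
  have h1 : (1 : ℤ) ∈ Idx m zero := by
    unfold Idx
    split_ifs <;> simp <;> omega
  have hn1 := hI.neg_mem 1 h1
  have m1 : met s 1 (-1) = 1 := by simp [met]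
  have m2 : metUp s (-1) 1 = 1 := by simp [metUp]
  have hexp := fun v => contrUp_Lquad (G := G) (H := H) hI (betaC m zero s) v h1 hn1
  simp only [m1, one_smul] at hexp
  obtain ⟨k₁, k₂, k₃, k₄, hexp⟩ : ∃ k₁ k₂ k₃ k₄ : A, ∀ v : ℂ,
      contrUp (Idx m zero) s (Lquad G H (v - betaC m zero s)) (Lquad G H v) 1 (-1)
        = v ^ 4 • 1 + v ^ 3 • k₁ + v ^ 2 • k₂ + v • k₃ + k₄ := ⟨_, _, _, _, hexp⟩
  refine ⟨k₁, k₂, k₃, k₄, fun v a ha b hb => ?_⟩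
  rw [← hexp v]
  have hdown := h.contr_proportional hI hs hm v hn1 h1 h1 hn1
  rw [m1, m2, one_smul, one_smul] at hdown
  constructor
  · have := h.contr_proportional hI hs hm v hn1 h1 ha hb
    rwa [m2, one_smul, ← hdown] at this
  · have := h.contr_proportional hI hs hm v ha hb h1 hn1
    rw [m1, one_smul] at this
    exact this.symm

lemma RLL.quartic_commute (h : RLL m zero s (Lquad G H))
    (hI : IsMetricIndex (Idx m zero) s) {C : A} {w : ℂ}
    (hC : ∀ a ∈ Idx m zero, ∀ b ∈ Idx m zero,
      contrUp (Idx m zero) s (Lquad G H (w - betaC m zero s)) (Lquad G H w) a b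
        = met s a b • C ∧
      contrDown (Idx m zero) s (Lquad G H (w - betaC m zero s)) (Lquad G H w) a b
        = metUp s a b • C)
    (v : ℂ) {a b : ℤ} (ha : a ∈ Idx m zero) (hb : b ∈ Idx m zero) :
    C * Lquad G H v a b = Lquad G H v a b * C := by
  have hcov : ∀ u, IsCovariant (Idx m zero) s G (Lquad G H u) :=
    fun u a ha c hc x hx y hy => h.commutator_linear hI u ha hx hc hy
  have hG : C * G a b = G a b * C :=
    hI.commute_of_covariant (hcov _) (hcov _) (fun a ha b hb => (hC a ha b hb).1) ha hb
  have hL : C * Lquad G H w a b = Lquad G H w a b * C :=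
    hI.commute_of_contr (fun a ha b hb => (hC a ha b hb).1)
      (fun a ha b hb => (hC a ha b hb).2) ha hb
  have h1 : C * (if a = b then 1 else 0) = (if a = b then 1 else 0) * C := by
    split_ifs <;> simp
  simp only [Lquad, mul_add, add_mul, mul_smul_comm, smul_mul_assoc, hG, h1] at hL ⊢
  rw [add_left_cancel hL]

end Relations

/-- the symmetric constraints of the quadratic evaluation, with central
values `c₁, c₂, c₃, c₄`. -/
theorem stmt5 (m : ℤ) (zero : Bool) (sgn : ℂ) (hm : 1 ≤ m)
    (hsgn : sgn = 1 ∨ sgn = -1) (hz : zero = true → sgn = 1)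
    (A : Type*) [Ring A] [Algebra ℂ A]
    (G H : ℤ → ℤ → A)
    (hRLL : RLL m zero sgn (Lquad G H)) :
    ∃ c1 c2 c3 c4 : A,
      (∀ v : ℂ, ∀ c ∈ Idx m zero, ∀ d ∈ Idx m zero,
        c1 * Llow m zero sgn (Lquad G H) v c d = Llow m zero sgn (Lquad G H) v c d * c1 ∧
        c2 * Llow m zero sgn (Lquad G H) v c d = Llow m zero sgn (Lquad G H) v c d * c2 ∧
        c3 * Llow m zero sgn (Lquad G H) v c d = Llow m zero sgn (Lquad G H) v c d * c3 ∧
        c4 * Llow m zero sgn (Lquad G H) v c d = Llow m zero sgn (Lquad G H) v c d * c4)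
      ∧ (∀ a ∈ Idx m zero, ∀ b ∈ Idx m zero,
          lowMat m zero sgn G a b + sgn • lowMat m zero sgn G b a = met sgn a b • c1)
      ∧ (∀ a ∈ Idx m zero, ∀ b ∈ Idx m zero,
          lowMat m zero sgn H a b + sgn • lowMat m zero sgn H b a
            + (∑ d ∈ Idx m zero, ∑ e ∈ Idx m zero,
                metUp sgn e d • (lowMat m zero sgn G d a * lowMat m zero sgn G e b))
            - betaC m zero sgn • lowMat m zero sgn G a b = met sgn a b • c2)
      ∧ (∀ a ∈ Idx m zero, ∀ b ∈ Idx m zero,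
          (∑ d ∈ Idx m zero, ∑ e ∈ Idx m zero,
              metUp sgn e d • (lowMat m zero sgn H d a * lowMat m zero sgn G e b
                + lowMat m zero sgn G d a * lowMat m zero sgn H e b))
            - betaC m zero sgn •
              (lowMat m zero sgn H a b - sgn • lowMat m zero sgn H b a) = met sgn a b • c3)
      ∧ (∀ a ∈ Idx m zero, ∀ b ∈ Idx m zero,
          (∑ d ∈ Idx m zero, ∑ e ∈ Idx m zero,
              metUp sgn e d • (lowMat m zero sgn H d a * lowMat m zero sgn H e b))
            - betaC m zero sgn •
              (∑ d ∈ Idx m zero, ∑ e ∈ Idx m zero,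
                metUp sgn e d • (lowMat m zero sgn G d a * lowMat m zero sgn H e b))
            + (betaC m zero sgn ^ 2) • lowMat m zero sgn H a b = met sgn a b • c4) := by
  have hI : IsMetricIndex (Idx m zero) sgn := isMetricIndex_Idx hsgn hz
  obtain ⟨k₁, k₂, k₃, k₄, hk⟩ := hRLL.exists_quartic hI hsgn hm
  set β := betaC m zero sgn
  have hcomm : ∀ v : ℂ, ∀ c ∈ Idx m zero, ∀ d ∈ Idx m zero,
      k₁ * Llow m zero sgn (Lquad G H) v c d = Llow m zero sgn (Lquad G H) v c d * k₁ ∧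
      k₂ * Llow m zero sgn (Lquad G H) v c d = Llow m zero sgn (Lquad G H) v c d * k₂ ∧
      k₃ * Llow m zero sgn (Lquad G H) v c d = Llow m zero sgn (Lquad G H) v c d * k₃ ∧
      k₄ * Llow m zero sgn (Lquad G H) v c d = Llow m zero sgn (Lquad G H) v c d * k₄ := by
    intro v c hc d hd
    have hlow : Llow m zero sgn (Lquad G H) v c d = metSign sgn c • Lquad G H v (-c) d :=
      hI.sum_met_smul hc fun x => Lquad G H v x d
    rw [hlow]
    generalize hM : Lquad G H v (-c) d = M
    have hz : ∀ w : ℂ, w ^ 4 • (0 : A) + w ^ 3 • (k₁ * M - M * k₁) + w ^ 2 • (k₂ * M - M * k₂)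
        + w • (k₃ * M - M * k₃) + (k₄ * M - M * k₄) = 0 := by
      intro w
      have := hRLL.quartic_commute hI (hk w) v (hI.neg_mem c hc) hd
      rw [hM] at this
      simp only [mul_add, add_mul, mul_smul_comm, smul_mul_assoc, one_mul, mul_one] at this
      linear_combination (norm := module) this
    obtain ⟨h4, h3, h2, h1, -⟩ := coeffs_eq_zero hz
    simp only [mul_smul_comm, smul_mul_assoc, sub_eq_zero.1 h1, sub_eq_zero.1 h2,
      sub_eq_zero.1 h3, sub_eq_zero.1 h4, and_self]
  have hcoeff : ∀ a ∈ Idx m zero, ∀ b ∈ Idx m zero,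
      lowMat m zero sgn G a b + sgn • lowMat m zero sgn G b a
        = met sgn a b • (k₁ + (2 * β) • 1) ∧
      lowMat m zero sgn H a b + sgn • lowMat m zero sgn H b a
        + contrUp (Idx m zero) sgn G G a b - (β * sgn) • lowMat m zero sgn G b a
        - (2 * β) • lowMat m zero sgn G a b = met sgn a b • (k₂ - β ^ 2 • 1) ∧
      contrUp (Idx m zero) sgn H G a b + contrUp (Idx m zero) sgn G H a b
        - (2 * β) • lowMat m zero sgn H a b - β • contrUp (Idx m zero) sgn G G a b
        + β ^ 2 • lowMat m zero sgn G a b = met sgn a b • k₃ ∧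
      contrUp (Idx m zero) sgn H H a b - β • contrUp (Idx m zero) sgn G H a b
        + β ^ 2 • lowMat m zero sgn H a b = met sgn a b • k₄ := by
    intro a ha b hb
    have hz : ∀ v : ℂ, v ^ 4 • (0 : A)
        + v ^ 3 • (lowMat m zero sgn G a b + sgn • lowMat m zero sgn G b a
          - met sgn a b • (k₁ + (2 * β) • 1))
        + v ^ 2 • (lowMat m zero sgn H a b + sgn • lowMat m zero sgn H b a
          + contrUp (Idx m zero) sgn G G a b - (β * sgn) • lowMat m zero sgn G b a
          - (2 * β) • lowMat m zero sgn G a b - met sgn a b • (k₂ - β ^ 2 • 1))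
        + v • (contrUp (Idx m zero) sgn H G a b + contrUp (Idx m zero) sgn G H a b
          - (2 * β) • lowMat m zero sgn H a b - β • contrUp (Idx m zero) sgn G G a b
          + β ^ 2 • lowMat m zero sgn G a b - met sgn a b • k₃)
        + (contrUp (Idx m zero) sgn H H a b - β • contrUp (Idx m zero) sgn G H a b
          + β ^ 2 • lowMat m zero sgn H a b - met sgn a b • k₄) = 0 := by
      intro v
      have h1 := (hk v a ha b hb).1
      rw [contrUp_Lquad hI β v ha hb] at h1
      linear_combination (norm := module) h1
    obtain ⟨h4, h3, h2, h1, -⟩ := coeffs_eq_zero hz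
    exact ⟨sub_eq_zero.1 h1, sub_eq_zero.1 h2, sub_eq_zero.1 h3, sub_eq_zero.1 h4⟩
  refine ⟨k₁ + (2 * β) • 1, k₂ + β • k₁ + β ^ 2 • 1, k₃ + β • (k₂ + β • k₁ + β ^ 2 • 1), k₄,
    fun v c hc d hd => ?_, fun a ha b hb => (hcoeff a ha b hb).1, fun a ha b hb => ?_,
    fun a ha b hb => ?_, fun a ha b hb => ?_⟩
  · obtain ⟨h1, h2, h3, h4⟩ := hcomm v c hc d hd
    simp only [add_mul, mul_add, smul_mul_assoc, mul_smul_comm, one_mul, mul_one, h1, h2, h3, h4,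
      and_self]
  · obtain ⟨h1, h2, -, -⟩ := hcoeff a ha b hb
    rw [sum_metUp_lowMat hI]
    linear_combination (norm := module) h2 + β • h1
  · obtain ⟨h1, h2, h3, -⟩ := hcoeff a ha b hb
    simp only [smul_add, Finset.sum_add_distrib]
    rw [sum_metUp_lowMat hI, sum_metUp_lowMat hI]
    linear_combination (norm := module) h3 + β • h2 + β ^ 2 • h1
  · rw [sum_metUp_lowMat hI, sum_metUp_lowMat hI]
    exact (hcoeff a ha b hb).2.2.2
end
end

section
/- Let V be a ℂ-vector space and, in the so(2m+1) case (ε = +1, n = 2m+1), let L(u) = u²·Id + u·G + H with entries in End(V) satisfy the RLL relation for the fundamental R-matrix, and let v₀ ∈ V be a highest weight vector with weight functions λ_a. Then for all u ∈ ℂ the additional m-th weight relation holds: λ_m(−u+1/2)·λ_{−m}(−u+1) = λ_0(−u+1/2)·λ_0(−u+1). -/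
noncomputable section

theorem met_one (a b : ℤ) : met 1 a b = if a = -b then 1 else 0 := by
  simp [met]

theorem metUp_one (a b : ℤ) : metUp 1 a b = if a = -b then 1 else 0 := by
  simp [metUp]

theorem mem_Idx_true {m a : ℤ} : a ∈ Idx m true ↔ -m ≤ a ∧ a ≤ m := by
  simp [Idx]

theorem Rmat_one_transpose (m : ℤ) (zero : Bool) (w : ℂ) (a1 a2 b1 b2 : ℤ) :
    Rmat m zero 1 w a1 a2 b1 b2 = Rmat m zero 1 w b1 b2 a1 a2 := by
  simp only [Rmat, met_one, metUp_one, eq_comm (a := a1), eq_comm (a := a2)]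
  have h2 : (-a2 = a1) ↔ (a1 = -a2) := eq_comm
  rw [if_congr h2 rfl rfl]
  ring

section Algebra

variable {A : Type*} [Ring A] [Algebra ℂ A]

theorem Llow_one_eq {m a : ℤ} (ha : a ∈ Idx m true) (L : ℂ → ℤ → ℤ → A) (u : ℂ) (b : ℤ) :
    Llow m true 1 L u a b = L u (-a) b := by
  have ha' : -a ∈ Idx m true := by
    rw [mem_Idx_true] at ha ⊢; constructor <;> linarith
  have h (c : ℤ) : met 1 a c • L u c b = if -a = c then L u c b else 0 := by
    have : (a = -c) ↔ (-a = c) := by constructor <;> intro h <;> linarith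
    rw [met_one, if_congr this rfl rfl, ite_smul, one_smul, zero_smul]
  simp only [Llow, h, Finset.sum_ite_eq, if_pos ha']

/-- The action of the fundamental `R`-matrix on a tensor with two lower indices. -/
theorem sum_Rmat_smul {m a1 a2 : ℤ} (h1 : a1 ∈ Idx m true) (h2 : a2 ∈ Idx m true) (w : ℂ)
    (f : ℤ → ℤ → A) :
    ∑ b1 ∈ Idx m true, ∑ b2 ∈ Idx m true, Rmat m true 1 w a1 a2 b1 b2 • f b1 b2
      = (w * (w + betaC m true 1)) • f a1 a2 + (w + betaC m true 1) • f a2 a1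
        - (w * if a1 = -a2 then 1 else 0) • ∑ b ∈ Idx m true, f b (-b) := by
  have key (b1 b2 : ℤ) : Rmat m true 1 w a1 a2 b1 b2 • f b1 b2
      = (if a2 = b2 then if a1 = b1 then (w * (w + betaC m true 1)) • f b1 b2 else 0 else 0)
        + (if a1 = b2 then if a2 = b1 then (w + betaC m true 1) • f b1 b2 else 0 else 0)
        - (if -b1 = b2 then (w * if a1 = -a2 then 1 else 0) • f b1 b2 else 0) := by
    have : (b1 = -b2) ↔ (-b1 = b2) := by constructor <;> intro h <;> linarith
    simp only [Rmat, met_one, metUp_one, if_congr this rfl rfl, sub_smul, add_smul]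
    split_ifs <;> module
  have hneg : ∀ b ∈ Idx m true, -b ∈ Idx m true := by
    intro b hb
    rw [mem_Idx_true] at hb ⊢; constructor <;> linarith
  simp only [key, Finset.sum_sub_distrib, Finset.sum_add_distrib, Finset.sum_ite_eq, if_pos h1,
    if_pos h2, Finset.smul_sum]
  congr 1
  exact Finset.sum_congr rfl fun b hb => if_pos (hneg b hb)

theorem RLL.expand {m : ℤ} {L : ℂ → ℤ → ℤ → A} (h : RLL m true 1 L) (w v : ℂ) {a1 a2 c1 c2 : ℤ}
    (ha1 : a1 ∈ Idx m true) (ha2 : a2 ∈ Idx m true)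
    (hc1 : c1 ∈ Idx m true) (hc2 : c2 ∈ Idx m true) :
    (w * (w + betaC m true 1)) • (L (v + w) a1 c1 * L v a2 c2)
        + (w + betaC m true 1) • (L (v + w) a2 c1 * L v a1 c2)
        - (w * if a1 = -a2 then 1 else 0) • ∑ b ∈ Idx m true, L (v + w) b c1 * L v (-b) c2
      = (w * (w + betaC m true 1)) • (L v a2 c2 * L (v + w) a1 c1)
        + (w + betaC m true 1) • (L v a2 c1 * L (v + w) a1 c2)
        - (w * if c1 = -c2 then 1 else 0) • ∑ b ∈ Idx m true, L v a2 (-b) * L (v + w) a1 b := by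
  have h' := h (v + w) v a1 ha1 a2 ha2 c1 hc1 c2 hc2
  simp only [add_sub_cancel_left] at h'
  rw [sum_Rmat_smul ha1 ha2 w fun b1 b2 => L (v + w) b1 c1 * L v b2 c2] at h'
  simp only [Rmat_one_transpose m true w _ _ c1 c2] at h'
  rw [sum_Rmat_smul hc1 hc2 w fun b1 b2 => L v a2 b2 * L (v + w) a1 b1] at h'
  exact h'

theorem cubic_coeff_eq_zero {E D C B F : A}
    (h : ∀ t : ℂ, t ^ 4 • E + t ^ 3 • D + t ^ 2 • C + t • B + F = 0) : D = 0 := by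
  linear_combination (norm := module) (1 / 12 : ℂ) • h 2 - (1 / 6 : ℂ) • h 1 + (1 / 6 : ℂ) • h (-1)
    - (1 / 12 : ℂ) • h (-2)

theorem Lquad_add (G H : ℤ → ℤ → A) (v t : ℂ) (a b : ℤ) :
    Lquad G H (v + t) a b = t ^ 2 • (if a = b then (1 : A) else 0)
      + t • (G a b + (2 * v) • (if a = b then (1 : A) else 0)) + Lquad G H v a b := by
  simp only [Lquad]
  module

/-- Away from the metric terms, the first-order generators act on `L(v)` as for `gl(n)`. -/
theorem RLL.commutator {m : ℤ} {G H : ℤ → ℤ → A} (h : RLL m true 1 (Lquad G H)) (v : ℂ)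
    {a1 a2 c1 c2 : ℤ} (ha1 : a1 ∈ Idx m true) (ha2 : a2 ∈ Idx m true)
    (hc1 : c1 ∈ Idx m true) (hc2 : c2 ∈ Idx m true) (ha : a1 ≠ -a2) (hc : c1 ≠ -c2) :
    G a1 c1 * Lquad G H v a2 c2 - Lquad G H v a2 c2 * G a1 c1
      = (if a1 = c2 then (1 : ℂ) else 0) • Lquad G H v a2 c1
        - (if a2 = c1 then (1 : ℂ) else 0) • Lquad G H v a1 c2 := by
  have ite_one (p : Prop) [Decidable p] :
      (if p then (1 : A) else 0) = (if p then (1 : ℂ) else 0) • (1 : A) := by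
    split_ifs <;> simp
  rw [← sub_eq_zero]
  set β := betaC m true 1 with hβ
  set d11 : ℂ := if a1 = c1 then 1 else 0 with hd11
  set d12 : ℂ := if a1 = c2 then 1 else 0 with hd12
  set d21 : ℂ := if a2 = c1 then 1 else 0 with hd21
  refine cubic_coeff_eq_zero (E := 0)
    (C := β • (G a1 c1 * Lquad G H v a2 c2 - Lquad G H v a2 c2 * G a1 c1)
      + (Lquad G H v a1 c1 * Lquad G H v a2 c2 - Lquad G H v a2 c2 * Lquad G H v a1 c1)
      + (G a2 c1 * Lquad G H v a1 c2 - Lquad G H v a2 c1 * G a1 c2)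
      + (β + 2 * v) • (d21 • Lquad G H v a1 c2 - d12 • Lquad G H v a2 c1))
    (B := β • (Lquad G H v a1 c1 * Lquad G H v a2 c2 - Lquad G H v a2 c2 * Lquad G H v a1 c1)
      + (Lquad G H v a2 c1 * Lquad G H v a1 c2 - Lquad G H v a2 c1 * Lquad G H v a1 c2)
      + β • (G a2 c1 * Lquad G H v a1 c2 - Lquad G H v a2 c1 * G a1 c2)
      + (2 * v * β) • (d21 • Lquad G H v a1 c2 - d12 • Lquad G H v a2 c1))
    (F := 0) fun t => ?_
  have e := h.expand t v ha1 ha2 hc1 hc2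
  rw [if_neg ha, if_neg hc] at e
  simp only [Lquad_add, ite_one, ← hd11, ← hd12, ← hd21, ← hβ, mul_zero, zero_smul, sub_zero,
    add_mul, mul_add, smul_mul_assoc, mul_smul_comm, one_mul, mul_one] at e
  linear_combination (norm := module) e

/-- The first-order generators with lowered indices are antisymmetric off the metric. -/
theorem RLL.antisymm {m : ℤ} (hm : 1 ≤ m) {G H : ℤ → ℤ → A} (h : RLL m true 1 (Lquad G H))
    {c1 c2 : ℤ} (hc1 : c1 ∈ Idx m true) (hc2 : c2 ∈ Idx m true) (hc : c1 ≠ -c2) :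
    G (-c2) c1 + G (-c1) c2 = 0 := by
  set β := betaC m true 1 with hβ
  have hβ0 : β ≠ 0 := by
    have : β = ((2 * m - 1 : ℤ) : ℂ) / 2 := by
      simp only [hβ, betaC, nDim, if_true]; push_cast; ring
    rw [this]
    exact div_ne_zero (Int.cast_ne_zero.mpr (by lia)) two_ne_zero
  have hm1 : m ∈ Idx m true := mem_Idx_true.mpr (by lia)
  have hm2 : -m ∈ Idx m true := mem_Idx_true.mpr (by lia)
  have hneg (b : ℤ) : (-b = c2) ↔ (b = -c2) := by lia
  have hc2' : -c2 ∈ Idx m true := mem_Idx_true.mpr (by rw [mem_Idx_true] at hc2; lia)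
  have key : ∑ b ∈ Idx m true, ((if b = c1 then (1 : A) else 0) * G (-b) c2
      + (G b c1 + (2 * -β) • (if b = c1 then (1 : A) else 0)) * (if -b = c2 then (1 : A) else 0))
      = 0 := by
    refine cubic_coeff_eq_zero
      (E := ∑ b ∈ Idx m true, (if b = c1 then (1 : A) else 0) * (if -b = c2 then (1 : A) else 0))
      (C := ∑ b ∈ Idx m true, ((if b = c1 then (1 : A) else 0) * H (-b) c2
        + (G b c1 + (2 * -β) • (if b = c1 then (1 : A) else 0)) * G (-b) c2
        + Lquad G H (-β) b c1 * (if -b = c2 then (1 : A) else 0)))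
      (B := ∑ b ∈ Idx m true,
        ((G b c1 + (2 * -β) • (if b = c1 then (1 : A) else 0)) * H (-b) c2
        + Lquad G H (-β) b c1 * G (-b) c2))
      (F := ∑ b ∈ Idx m true, Lquad G H (-β) b c1 * H (-b) c2) fun t => ?_
    have e := h.expand (-β) t hm1 hm2 hc1 hc2
    rw [if_neg hc, if_pos (neg_neg m).symm, ← hβ] at e
    simp only [neg_add_cancel, mul_zero, zero_smul, zero_sub, mul_one, add_zero, neg_smul,
      neg_neg, sub_zero, smul_eq_zero, hβ0, false_or] at e
    refine Eq.trans ?_ e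
    simp only [Finset.smul_sum, ← Finset.sum_add_distrib]
    refine Finset.sum_congr rfl fun b _ => ?_
    have hL : Lquad G H t (-b) c2
        = t ^ 2 • (if -b = c2 then (1 : A) else 0) + t • G (-b) c2 + H (-b) c2 := rfl
    rw [add_comm t, Lquad_add, hL]
    simp only [add_mul, mul_add, smul_mul_assoc, mul_smul_comm]
    module
  have hz (b : ℤ) : (if b = c1 then (1 : A) else 0) * (if b = -c2 then (1 : A) else 0) = 0 := by
    split_ifs with h1 h2
    · exact absurd (h1.symm.trans h2) hc
    all_goals simp
  simp only [hneg, add_mul, smul_mul_assoc, hz, smul_zero, add_zero] at key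
  simp only [ite_mul, one_mul, zero_mul,
    mul_ite, mul_one, mul_zero, Finset.sum_add_distrib, Finset.sum_ite_eq', hc1, hc2', if_true]
    at key
  rw [add_comm]
  exact key

end Algebra

/-- If the diagonal entries `L^a_a` have joint eigenvector `v₀`, the relevant off-diagonal entries
annihilate it and `λ_i λ_{-i}` does not depend on `i`, then `λ_m λ_{-m} = λ_0 λ_0` at arguments
differing by `1/2`. -/
theorem weight_relation {m : ℤ} (hm : 1 ≤ m) {V : Type*} [AddCommGroup V] [Module ℂ V]
    {L : ℂ → ℤ → ℤ → Module.End ℂ V} (h : RLL m true 1 L) {v₀ : V} (hv₀ : v₀ ≠ 0)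
    (lam : ℤ → ℂ → ℂ)
    (pn : ∀ u i j, 1 ≤ i ∧ i ≤ m → 1 ≤ j ∧ j ≤ m → L u i (-j) v₀ = 0)
    (pp_eq : ∀ u i, 1 ≤ i ∧ i ≤ m → L u i i v₀ = lam i (-u) • v₀)
    (nn_ne : ∀ u i j, 1 ≤ i ∧ i ≤ m → 1 ≤ j ∧ j ≤ m → i ≠ j → L u (-j) (-i) v₀ = 0)
    (nn_eq : ∀ u i, 1 ≤ i ∧ i ≤ m → L u (-i) (-i) v₀ = lam (-i) (-u) • v₀)
    (zn : ∀ u i, 1 ≤ i ∧ i ≤ m → L u 0 (-i) v₀ = 0)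
    (zz : ∀ u, L u 0 0 v₀ = lam 0 (-u) • v₀)
    (heq : ∀ i, 1 ≤ i ∧ i ≤ m → ∀ x y, lam i x * lam (-i) y = lam m x * lam (-m) y) (u : ℂ) :
    lam m (-u + 1 / 2) * lam (-m) (-u + 1) = lam 0 (-u + 1 / 2) * lam 0 (-u + 1) := by
  have hx : -(u - 1 + 1 / 2) = -u + 1 / 2 := by ring
  have hy : -(u - 1) = -u + 1 := by ring
  have hwβ : (1 / 2 : ℂ) + betaC m true 1 = m := by
    simp only [betaC, nDim, if_true]; push_cast; ring
  set P := lam m (-u + 1 / 2) * lam (-m) (-u + 1) with hP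
  set Q := lam 0 (-u + 1 / 2) * lam 0 (-u + 1) with hQ
  set X : ℤ → V := fun i => L (u - 1) 0 (-i) (L (u - 1 + 1 / 2) 0 i v₀) with hX
  have hsumX : ∑ b ∈ Idx m true, X b = Q • v₀ + ∑ b ∈ Finset.Icc 1 m, X b := by
    have hX0 : X 0 = Q • v₀ := by
      simp only [hX, neg_zero, zz, map_smul, smul_smul, hx, hy, hQ]
    rw [← hX0, ← Finset.sum_insert (by simp)]
    refine (Finset.sum_subset (fun b hb => ?_) fun b hb hb' => ?_).symm
    · rw [Finset.mem_insert, Finset.mem_Icc] at hb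
      exact mem_Idx_true.mpr (by lia)
    · rw [mem_Idx_true] at hb
      rw [Finset.mem_insert, Finset.mem_Icc] at hb'
      have := zn (u - 1 + 1 / 2) (-b) ⟨by lia, by lia⟩
      rw [neg_neg] at this
      simp only [hX, this, map_zero]
  have hS (i : ℤ) (hi : 1 ≤ i) (hi' : i ≤ m) :
      ∑ b ∈ Idx m true, L (u - 1 + 1 / 2) b i (L (u - 1) (-b) (-i) v₀) = P • v₀ := by
    rw [Finset.sum_eq_single i]
    · rw [nn_eq _ i ⟨hi, hi'⟩, map_smul, pp_eq _ i ⟨hi, hi'⟩, smul_smul, mul_comm, hx, hy, hP]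
      rw [heq i ⟨hi, hi'⟩]
    · intro b hb hbi
      rw [mem_Idx_true] at hb
      have : L (u - 1) (-b) (-i) v₀ = 0 := by
        rcases lt_trichotomy b 0 with hb0 | rfl | hb0
        · exact pn _ (-b) i ⟨by lia, by lia⟩ ⟨hi, hi'⟩
        · rw [neg_zero]; exact zn _ i ⟨hi, hi'⟩
        · exact nn_ne _ i b ⟨hi, hi'⟩ ⟨by lia, hb.2⟩ hbi.symm
      rw [this, map_zero]
    · exact fun hni => absurd (mem_Idx_true.mpr (by lia)) hni
  have main (i : ℤ) (hi : i ∈ Finset.Icc 1 m) :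
      P • v₀ + (m : ℂ) • X i = Q • v₀ + ∑ b ∈ Finset.Icc 1 m, X b := by
    rw [Finset.mem_Icc] at hi
    have h0 : (0 : ℤ) ∈ Idx m true := mem_Idx_true.mpr (by lia)
    have e := DFunLike.congr_fun (h.expand (1 / 2) (u - 1) h0 h0 (c1 := i) (c2 := -i)
      (mem_Idx_true.mpr (by lia)) (mem_Idx_true.mpr (by lia))) v₀
    rw [if_pos neg_zero.symm, if_pos (neg_neg i).symm, hwβ] at e
    simp only [LinearMap.sub_apply, LinearMap.add_apply, LinearMap.smul_apply, LinearMap.sum_apply,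
      Module.End.mul_apply, zn _ i hi, map_zero, smul_zero, hS i hi.1 hi.2] at e
    rw [← hsumX]
    linear_combination (norm := module) (-2 : ℂ) • e
  have total := Finset.sum_congr rfl main
  rw [Finset.sum_add_distrib, ← Finset.smul_sum, ← Finset.smul_sum] at total
  simp only [Finset.sum_const, Int.card_Icc, add_sub_cancel_right] at total
  have hcast (y : V) : m.toNat • y = (m : ℂ) • y := by
    rw [← Nat.cast_smul_eq_nsmul ℂ, ← Int.cast_natCast, Int.toNat_of_nonneg (by lia)]
  rw [hcast, hcast] at total
  have hPQ : ((m : ℂ) * (P - Q)) • v₀ = 0 := by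
    linear_combination (norm := module) total
  have hm0 : (m : ℂ) ≠ 0 := Int.cast_ne_zero.mpr (by lia)
  exact sub_eq_zero.mp
    ((mul_eq_zero.mp ((smul_eq_zero_iff_left hv₀).mp hPQ)).resolve_left hm0)

/-- the additional `m`-th weight relation in the `so(2m+1)` case. -/
theorem stmt8 (m : ℤ) (hm : 1 ≤ m)
    (V : Type*) [AddCommGroup V] [Module ℂ V]
    (G H : ℤ → ℤ → Module.End ℂ V)
    (hRLL : RLL m true 1 (Lquad G H))
    (v₀ : V) (hv₀ : v₀ ≠ 0) (lam : ℤ → ℂ → ℂ)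
    (hw1 : ∀ u : ℂ, ∀ i j : ℤ, 1 ≤ i → i < j → j ≤ m →
      Llow m true 1 (Lquad G H) u (-i) j v₀ = 0)
    (hw2 : ∀ u : ℂ, ∀ i j : ℤ, 1 ≤ i → i ≤ m → 1 ≤ j → j ≤ m →
      Llow m true 1 (Lquad G H) u (-i) (-j) v₀ = 0)
    (hw3 : ∀ u : ℂ, ∀ i : ℤ, 1 ≤ i → i ≤ m →
      Llow m true 1 (Lquad G H) u (-i) i v₀ = lam i (-u) • v₀)
    (hw4 : ∀ u : ℂ, ∀ i j : ℤ, 1 ≤ j → j < i → i ≤ m →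
      Llow m true 1 (Lquad G H) u j (-i) v₀ = 0)
    (hw5 : ∀ u : ℂ, ∀ i : ℤ, 1 ≤ i → i ≤ m →
      Llow m true 1 (Lquad G H) u i (-i) v₀ = lam (-i) (-u) • v₀)
    (hw0 : ∀ u : ℂ,
      (∀ i : ℤ, 1 ≤ i → i ≤ m →
        Llow m true 1 (Lquad G H) u (-i) 0 v₀ = 0 ∧
        Llow m true 1 (Lquad G H) u 0 (-i) v₀ = 0) ∧
      Llow m true 1 (Lquad G H) u 0 0 v₀ = lam 0 (-u) • v₀) :
    ∀ u : ℂ,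
      lam m (-u + 1 / 2) * lam (-m) (-u + 1) = lam 0 (-u + 1 / 2) * lam 0 (-u + 1) := by
  set L := Lquad G H with hL
  have low (u : ℂ) {a : ℤ} (b : ℤ) (ha : -m ≤ a ∧ a ≤ m) : Llow m true 1 L u a b = L u (-a) b :=
    Llow_one_eq (mem_Idx_true.mpr ha) L u b
  have pp_lt (u : ℂ) (i j : ℤ) (hi : 1 ≤ i) (hij : i < j) (hj : j ≤ m) : L u i j v₀ = 0 := by
    have := hw1 u i j hi hij hj
    rwa [low u j (by lia), neg_neg] at this
  have pn (u : ℂ) (i j : ℤ) (hi : 1 ≤ i) (hi' : i ≤ m) (hj : 1 ≤ j) (hj' : j ≤ m) :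
      L u i (-j) v₀ = 0 := by
    have := hw2 u i j hi hi' hj hj'
    rwa [low u (-j) (by lia), neg_neg] at this
  have pp_eq (u : ℂ) (i : ℤ) (hi : 1 ≤ i) (hi' : i ≤ m) : L u i i v₀ = lam i (-u) • v₀ := by
    have := hw3 u i hi hi'
    rwa [low u i (by lia), neg_neg] at this
  have nn_lt (u : ℂ) (i j : ℤ) (hj : 1 ≤ j) (hij : j < i) (hi : i ≤ m) :
      L u (-j) (-i) v₀ = 0 := by
    have := hw4 u i j hj hij hi
    rwa [low u (-i) (by lia)] at this
  have nn_eq (u : ℂ) (i : ℤ) (hi : 1 ≤ i) (hi' : i ≤ m) :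
      L u (-i) (-i) v₀ = lam (-i) (-u) • v₀ := by
    have := hw5 u i hi hi'
    rwa [low u (-i) (by lia)] at this
  have zn (u : ℂ) (i : ℤ) (hi : 1 ≤ i) (hi' : i ≤ m) : L u 0 (-i) v₀ = 0 := by
    have := ((hw0 u).1 i hi hi').2
    rwa [low u (-i) (by lia), neg_zero] at this
  have zz (u : ℂ) : L u 0 0 v₀ = lam 0 (-u) • v₀ := by
    have := (hw0 u).2
    rwa [low u 0 (by lia), neg_zero] at this
  have G_kill (a b : ℤ) (hab : a ≠ b) (h : ∀ u, L u a b v₀ = 0) : G a b v₀ = 0 := by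
    have h1 := h 1
    have h0 := h 0
    simp only [hL, Lquad, if_neg hab, smul_zero, zero_add, one_smul, zero_smul,
      LinearMap.add_apply] at h1 h0
    rwa [h0, add_zero] at h1
  have anti (i j : ℤ) (hi : 1 ≤ i) (hi' : i ≤ m) (hj : 1 ≤ j) (hj' : j ≤ m) (hij : i ≠ j) :
      G i j v₀ + G (-j) (-i) v₀ = 0 := by
    have := hRLL.antisymm hm (c1 := j) (c2 := -i) (mem_Idx_true.mpr (by lia))
      (mem_Idx_true.mpr (by lia)) (by lia)
    rw [neg_neg] at this
    exact DFunLike.congr_fun this v₀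
  have Gnn (i j : ℤ) (hi : 1 ≤ i) (hi' : i ≤ m) (hj : 1 ≤ j) (hj' : j ≤ m) (hij : i ≠ j) :
      G (-j) (-i) v₀ = 0 := by
    rcases lt_or_gt_of_ne hij with h | h
    · have := anti i j hi hi' hj hj' hij
      rwa [G_kill i j hij fun u => pp_lt u i j hi h hj', zero_add] at this
    · exact G_kill (-j) (-i) (by lia) fun u => nn_lt u i j hj h hi'
  have Gpp (i j : ℤ) (hi : 1 ≤ i) (hi' : i ≤ m) (hj : 1 ≤ j) (hj' : j ≤ m) (hij : i ≠ j) :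
      G i j v₀ = 0 := by
    have := anti i j hi hi' hj hj' hij
    rwa [Gnn i j hi hi' hj hj' hij, add_zero] at this
  have nn_ne (u : ℂ) (i j : ℤ) (hi : 1 ≤ i) (hi' : i ≤ m) (hj : 1 ≤ j) (hj' : j ≤ m)
      (hij : i ≠ j) : L u (-j) (-i) v₀ = 0 := by
    have e := DFunLike.congr_fun (hRLL.commutator u (a1 := -j) (a2 := -i) (c1 := -i) (c2 := -i)
      (mem_Idx_true.mpr (by lia)) (mem_Idx_true.mpr (by lia)) (mem_Idx_true.mpr (by lia))
      (mem_Idx_true.mpr (by lia)) (by lia) (by lia)) v₀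
    rw [if_neg (by lia), if_pos rfl, ← hL] at e
    simpa [nn_eq u i hi hi', Gnn i j hi hi' hj hj' hij] using e.symm
  have lam_neg (x : ℂ) (i j : ℤ) (hi : 1 ≤ i) (hi' : i ≤ m) (hj : 1 ≤ j) (hj' : j ≤ m)
      (hij : i ≠ j) : lam (-i) x = lam (-j) x := by
    have e := DFunLike.congr_fun (hRLL.commutator (-x) (a1 := -j) (a2 := -i) (c1 := -i) (c2 := -j)
      (mem_Idx_true.mpr (by lia)) (mem_Idx_true.mpr (by lia)) (mem_Idx_true.mpr (by lia))
      (mem_Idx_true.mpr (by lia)) (by lia) (by lia)) v₀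
    rw [if_pos rfl, if_pos rfl, ← hL] at e
    simp only [LinearMap.sub_apply, Module.End.mul_apply, nn_ne _ j i hj hj' hi hi' hij.symm,
      Gnn i j hi hi' hj hj' hij, map_zero, one_smul, nn_eq _ i hi hi', nn_eq _ j hj hj',
      neg_neg, ← sub_smul, sub_self] at e
    exact sub_eq_zero.mp ((smul_eq_zero_iff_left hv₀).mp e.symm)
  have lam_pos_lt (x : ℂ) (i j : ℤ) (hi : 1 ≤ i) (hij : i < j) (hj : j ≤ m) :
      lam i x = lam j x := by
    have e := DFunLike.congr_fun (hRLL.commutator (-x) (a1 := j) (a2 := i) (c1 := i) (c2 := j)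
      (mem_Idx_true.mpr (by lia)) (mem_Idx_true.mpr (by lia)) (mem_Idx_true.mpr (by lia))
      (mem_Idx_true.mpr (by lia)) (by lia) (by lia)) v₀
    rw [if_pos rfl, if_pos rfl, ← hL] at e
    simp only [LinearMap.sub_apply, Module.End.mul_apply, pp_lt _ i j hi hij hj,
      Gpp j i (by lia) hj hi (by lia) hij.ne', map_zero, one_smul, pp_eq _ i hi (by lia),
      pp_eq _ j (by lia) hj, neg_neg, ← sub_smul, sub_self] at e
    exact sub_eq_zero.mp ((smul_eq_zero_iff_left hv₀).mp e.symm)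
  refine weight_relation hm hRLL hv₀ lam (fun u i j hi hj => pn u i j hi.1 hi.2 hj.1 hj.2)
    (fun u i hi => pp_eq u i hi.1 hi.2)
    (fun u i j hi hj => nn_ne u i j hi.1 hi.2 hj.1 hj.2) (fun u i hi => nn_eq u i hi.1 hi.2)
    (fun u i hi => zn u i hi.1 hi.2) zz fun i hi x y => ?_
  rcases hi.2.lt_or_eq with h | rfl
  · rw [lam_pos_lt x i m hi.1 h le_rfl, lam_neg y i m hi.1 hi.2 hm le_rfl h.ne]
  · rfl
end
end
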